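/- Consider elements a₁, b₁, c₁, t₁, a₂, b₂, c₂, t₂, a₃, b₃, c₃, t₃, ā₄, b̄₄, c̄₄, t̄₄, ā₅, b̄₅, c̄₅, t̄₅, ā₆, b̄₆, c̄₆, t̄₆ of ℤ/2ℤ satisfying the eighteen equations: a₁+t₁ = b̄₄+c̄₄; ā₄+t̄₄ = b₁+c₁; b₁+t₁ = b̄₅+c̄₅; ā₅+t̄₅ = a₁+c₁; c₁+t₁ = b̄₆+c̄₆; ā₆+t̄₆ = a₁+b₁; a₂+t₂ = ā₄+c̄₄; b̄₄+t̄₄ = b₂+c₂; b₂+t₂ = ā₅+c̄₅; b̄₅+t̄₅ = a₂+c₂; c₂+t₂ = ā₆+c̄₆; b̄₆+t̄₆ = a₂+b₂; a₃+t₃ = ā₄+b̄₄; c̄₄+t̄₄ = b₃+c₃; b₃+t₃ = ā₅+b̄₅; c̄₅+t̄₅ = a₃+c₃; c₃+t₃ = ā₆+b̄₆; c̄₆+t̄₆ = a₃+b₃. Group the variables into six rows: (a₁,b₁,c₁,t₁), (a₂,b₂,c₂,t₂), (a₃,b₃,c₃,t₃), (ā₄,b̄₄,c̄₄,t̄₄),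 (ā₅,b̄₅,c̄₅,t̄₅), (ā₆,b̄₆,c̄₆,t̄₆). Then there is no solution in which, for some row, one designated variable of that row equals 1 and the other three variables of that row equal 0. (This shows that the cohomological obstruction is non-vanishing for every section in the support of the Peres–Mermin magic square, witnessing its strong contextuality.) -/

import Mathlib

/-- `oneHotRow w x y z` says that one designated variable of the row `(w, x, y, z)` equals `1`
and the other three equal `0`. -/
def oneHotRow (w x y z : ZMod 2) : Prop :=
  (w = 1 ∧ x = 0 ∧ y = 0 ∧ z = 0) ∨ (x = 1 ∧ w = 0 ∧ y = 0 ∧ z = 0) ∨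
  (y = 1 ∧ w = 0 ∧ x = 0 ∧ z = 0) ∨ (z = 1 ∧ w = 0 ∧ x = 0 ∧ y = 0)

/-- A one-hot row has sum `1`. -/
theorem oneHotRow.sum_eq_one {w x y z : ZMod 2} (h : oneHotRow w x y z) :
    w + x + y + z = 1 := by
  rcases h with ⟨rfl, rfl, rfl, rfl⟩ | ⟨rfl, rfl, rfl, rfl⟩ | ⟨rfl, rfl, rfl, rfl⟩ |
    ⟨rfl, rfl, rfl, rfl⟩ <;> simp

/-- If elements `a₁, …, t̄₆` of `ℤ/2ℤ` satisfy the eighteen compatibility equations of the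
Peres–Mermin magic square, then no row `(aᵢ,bᵢ,cᵢ,tᵢ)` (row contexts) or `(āⱼ,b̄ⱼ,c̄ⱼ,t̄ⱼ)`
(column contexts) has one designated variable equal to `1` and the other three equal to `0`.
(This is the non-vanishing of the cohomological obstruction for every section in the support of
the Peres–Mermin square, witnessing its strong contextuality.) -/
theorem peres_mermin_obstruction_nonvanishing
    (a1 b1 c1 t1 a2 b2 c2 t2 a3 b3 c3 t3 : ZMod 2)
    (a4 b4 c4 t4 a5 b5 c5 t5 a6 b6 c6 t6 : ZMod 2)
    (h1 : a1 + t1 = b4 + c4) (h2 : a4 + t4 = b1 + c1)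
    (h3 : b1 + t1 = b5 + c5) (h4 : a5 + t5 = a1 + c1)
    (h5 : c1 + t1 = b6 + c6) (h6 : a6 + t6 = a1 + b1)
    (h7 : a2 + t2 = a4 + c4) (h8 : b4 + t4 = b2 + c2)
    (h9 : b2 + t2 = a5 + c5) (h10 : b5 + t5 = a2 + c2)
    (h11 : c2 + t2 = a6 + c6) (h12 : b6 + t6 = a2 + b2)
    (h13 : a3 + t3 = a4 + b4) (h14 : c4 + t4 = b3 + c3)
    (h15 : b3 + t3 = a5 + b5) (h16 : c5 + t5 = a3 + c3)
    (h17 : c3 + t3 = a6 + b6) (h18 : c6 + t6 = a3 + b3) :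
    ¬(oneHotRow a1 b1 c1 t1 ∨ oneHotRow a2 b2 c2 t2 ∨ oneHotRow a3 b3 c3 t3 ∨
      oneHotRow a4 b4 c4 t4 ∨ oneHotRow a5 b5 c5 t5 ∨ oneHotRow a6 b6 c6 t6) := by
  -- The two equations at each intersection say that the row sum equals the column sum.
  have two : (2 : ZMod 2) = 0 := rfl
  have e14 : a1 + b1 + c1 + t1 = a4 + b4 + c4 + t4 := by linear_combination h1 - h2
  have e15 : a1 + b1 + c1 + t1 = a5 + b5 + c5 + t5 := by linear_combination h3 - h4
  have e16 : a1 + b1 + c1 + t1 = a6 + b6 + c6 + t6 := by linear_combination h5 - h6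
  have e24 : a2 + b2 + c2 + t2 = a4 + b4 + c4 + t4 := by linear_combination h7 - h8
  have e34 : a3 + b3 + c3 + t3 = a4 + b4 + c4 + t4 := by linear_combination h13 - h14
  -- Adding one equation per intersection cancels every column.
  have hsum : (a1 + b1 + c1 + t1) + (a2 + b2 + c2 + t2) + (a3 + b3 + c3 + t3) = 0 := by
    linear_combination h1 + h3 + h5 + h7 + h9 + h11 + h13 + h15 + h17 +
      (a4 + b4 + c4 + a5 + b5 + c5 + a6 + b6 + c6 - t1 - t2 - t3) * two
  have hzero : a4 + b4 + c4 + t4 = 0 := by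
    linear_combination hsum - e14 - e24 - e34 - (a4 + b4 + c4 + t4) * two
  rintro (h | h | h | h | h | h) <;> refine one_ne_zero (h.sum_eq_one.symm.trans ?_)
  · exact e14.trans hzero
  · exact e24.trans hzero
  · exact e34.trans hzero
  · exact hzero
  · exact e15.symm.trans (e14.trans hzero)
  · exact e16.symm.trans (e14.trans hzero)
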